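/- arXiv:2509.03258 — 2 statements merged into one kernel-verified Lean document; each statement's English description precedes it below -/
import Mathlib

section
/- In the GME model setting, assume: condition (C1) (𝔡(x) := f(Ax) − (μ/2)‖B𝔏x‖² is convex on X); f is differentiable on Y with Lipschitz continuous gradient; the solution set S := argmin{J(x) : ℭx ∈ Δ} is nonempty; and the subdifferential calculus rules ∂(J + ι_Δ∘ℭ) = ∂J + ∂(ι_Δ∘ℭ), ∂(Ψ∘𝔏) = 𝔏*∘(∂Ψ)∘𝔏, and ∂(ι_Δ∘ℭ) = ℭ*∘(∂ι_Δ)∘ℭ hold. Let σ, τ > 0 and define T : X×Z×Z×𝔷 → X×Z×Z×𝔷 by T(x,v,w,z) = (ξ,ζ,η,ς) where ξ := x − (1/σ)∇𝔡(x) − (μ/σ)𝔏*B*Bv − (μ/σ)𝔏*w − (μ/σ)ℭ*z; ζ := Prox_{(μ/τ)Ψ}((2μ/τ)B*B𝔏ξ − (μ/τ)B*B𝔏x + v − (μ/τ)B*Bv); η := Prox_{Ψ*}(2𝔏ξ − 𝔏x + w); ς := (Id − P_Δ)(2ℭξ − ℭx + z). Then S = {x ∈ X : there exist (v,w,z) ∈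 Z×Z×𝔷 with T(x,v,w,z) = (x,v,w,z)}. -/
open scoped Pointwise RealInnerProductSpace

noncomputable section

/-- Convexity for extended-real-valued functions. -/
def EConvex {H : Type*} [AddCommGroup H] [Module ℝ H] (φ : H → EReal) : Prop :=
  ∀ (x y : H) (a b : ℝ), 0 ≤ a → 0 ≤ b → a + b = 1 →
    φ (a • x + b • y) ≤ (a : EReal) * φ x + (b : EReal) * φ y

/-- Coercivity (`φ u → ∞` as `‖u‖ → ∞`) for extended-real-valued functions. -/
def ECoercive {H : Type*} [NormedAddCommGroup H] (φ : H → EReal) : Prop :=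
  ∀ C : ℝ, ∃ R : ℝ, ∀ x : H, R ≤ ‖x‖ → (C : EReal) ≤ φ x

/-- Legendre–Fenchel conjugate `φ*(y) = sup_v (⟨v, y⟩ − φ(v))`. -/
noncomputable def fenchel {H : Type*} [NormedAddCommGroup H] [InnerProductSpace ℝ H]
    (φ : H → EReal) (y : H) : EReal :=
  ⨆ v : H, ((⟪v, y⟫ : ℝ) : EReal) - φ v

/-- Generalized Moreau enhanced function `Ψ_B(z) = Ψ(z) − inf_v [Ψ(v) + (1/2)‖B(z−v)‖²]`. -/
noncomputable def GME {Z Z' : Type*} [NormedAddCommGroup Z] [InnerProductSpace ℝ Z]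
    [NormedAddCommGroup Z'] [InnerProductSpace ℝ Z']
    (Ψ : Z → EReal) (B : Z →ₗ[ℝ] Z') (z : Z) : EReal :=
  Ψ z - ⨅ v : Z, (Ψ v + ((((1 : ℝ) / 2) * ‖B (z - v)‖ ^ 2 : ℝ) : EReal))

/-- The cost function `J(x) = f(Ax) + μ Ψ_B(𝔏x)`. -/
noncomputable def Jcost {X Y Z Z' : Type*}
    [NormedAddCommGroup X] [InnerProductSpace ℝ X]
    [NormedAddCommGroup Y] [InnerProductSpace ℝ Y]
    [NormedAddCommGroup Z] [InnerProductSpace ℝ Z]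
    [NormedAddCommGroup Z'] [InnerProductSpace ℝ Z']
    (A : X →ₗ[ℝ] Y) (Lm : X →ₗ[ℝ] Z) (B : Z →ₗ[ℝ] Z')
    (f : Y → ℝ) (Ψ : Z → EReal) (μ : ℝ) (x : X) : EReal :=
  ((f (A x) : ℝ) : EReal) + (μ : EReal) * GME Ψ B (Lm x)

/-- Subdifferential of an extended-real-valued function. -/
def esubdiff {H : Type*} [NormedAddCommGroup H] [InnerProductSpace ℝ H]
    (φ : H → EReal) (x : H) : Set H :=
  {u : H | ∀ y : H, φ x + ((⟪y - x, u⟫ : ℝ) : EReal) ≤ φ y}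

-- Indicator function `ι_Δ` of a set (0 on Δ, ∞ outside).
open Classical in
noncomputable def eindicator {W : Type*} (Δ : Set W) (p : W) : EReal :=
  if p ∈ Δ then 0 else ⊤

/-- The operator `T` of the proposed algorithm. -/
noncomputable def Tmap {X Z Z' W : Type*}
    [NormedAddCommGroup X] [InnerProductSpace ℝ X] [FiniteDimensional ℝ X]
    [NormedAddCommGroup Z] [InnerProductSpace ℝ Z] [FiniteDimensional ℝ Z]
    [NormedAddCommGroup Z'] [InnerProductSpace ℝ Z'] [FiniteDimensional ℝ Z']
    [NormedAddCommGroup W] [InnerProductSpace ℝ W] [FiniteDimensional ℝ W]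
    (Lm : X →ₗ[ℝ] Z) (B : Z →ₗ[ℝ] Z') (Cm : X →ₗ[ℝ] W)
    (grad𝔡 : X → X) (prox1 prox2 : Z → Z) (PΔ : W → W) (μ σ τ : ℝ)
    (h : X × Z × Z × W) : X × Z × Z × W :=
  let x := h.1
  let v := h.2.1
  let w := h.2.2.1
  let z := h.2.2.2
  let ξ := x - (1 / σ) • grad𝔡 x
      - (μ / σ) • (LinearMap.adjoint Lm) ((LinearMap.adjoint B) (B v))
      - (μ / σ) • (LinearMap.adjoint Lm) w - (μ / σ) • (LinearMap.adjoint Cm) z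
  let ζ := prox1 ((2 * μ / τ) • (LinearMap.adjoint B) (B (Lm ξ))
      - (μ / τ) • (LinearMap.adjoint B) (B (Lm x))
      + (v - (μ / τ) • (LinearMap.adjoint B) (B v)))
  let η := prox2 ((2 : ℝ) • Lm ξ - Lm x + w)
  let ς := ((2 : ℝ) • Cm ξ - Cm x + z) - PΔ ((2 : ℝ) • Cm ξ - Cm x + z)
  (ξ, ζ, η, ς)

theorem nonneg_of_forall_mul_add_sq_mul {a b : ℝ}
    (h : ∀ t : ℝ, 0 < t → t ≤ 1 → 0 ≤ t * a + t ^ 2 * b) : 0 ≤ a := by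
  by_contra! ha
  have hb : 0 < |b| + 1 := by positivity
  set t := min 1 (-a / (2 * (|b| + 1)))
  have ht0 : 0 < t := lt_min one_pos (by apply div_pos <;> linarith)
  have ht1 : t * (2 * (|b| + 1)) ≤ -a := by
    rw [← le_div_iff₀ (by positivity)]
    exact min_le_right _ _
  have h1 := h t ht0 (min_le_left _ _)
  have h2 : 0 ≤ a + t * b := by
    by_contra! h3
    nlinarith [mul_pos_of_neg_of_neg (neg_lt_zero.mpr ht0) h3]
  nlinarith [mul_le_mul_of_nonneg_left (le_abs_self b) ht0.le]

theorem exists_real_eq {H : Type*} {φ : H → EReal} (hbot : ∀ z, φ z ≠ ⊥) {x : H} (hx : φ x ≠ ⊤) :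
    ∃ r : ℝ, φ x = r :=
  ⟨(φ x).toReal, (EReal.coe_toReal hx (hbot x)).symm⟩

theorem ne_top_of_minimizer {H : Type*} {φ : H → EReal} {g : H → ℝ} {v v₀ : H} (hv₀ : φ v₀ ≠ ⊤)
    (hmin : ∀ v', φ v + (g v : EReal) ≤ φ v' + (g v' : EReal)) : φ v ≠ ⊤ := by
  intro hv
  have h := hmin v₀
  rw [hv, EReal.top_add_coe, top_le_iff] at h
  exact EReal.add_ne_top hv₀ (EReal.coe_ne_top _) h

section Subdifferential

variable {H K : Type*} [NormedAddCommGroup H] [InnerProductSpace ℝ H]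
  [NormedAddCommGroup K] [InnerProductSpace ℝ K]

theorem EConvex.const_mul {φ : H → EReal} (hφ : EConvex φ) {c : ℝ} (hc : 0 ≤ c) :
    EConvex fun x => (c : EReal) * φ x := by
  intro x y a b ha hb hab
  have hc' : (0 : EReal) ≤ c := by exact_mod_cast hc
  calc (c : EReal) * φ (a • x + b • y) ≤ c * (a * φ x + b * φ y) :=
        mul_le_mul_of_nonneg_left (hφ x y a b ha hb hab) hc'
    _ = _ := by
        rw [EReal.left_distrib_of_nonneg_of_ne_top hc' (EReal.coe_ne_top c),
          mul_left_comm, mul_left_comm (c : EReal) (b : EReal)]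

theorem EConvex.mem_esubdiff_of_minimizer {φ : H → EReal} (hφ : EConvex φ)
    (hbot : ∀ z, φ z ≠ ⊥) (B : H →ₗ[ℝ] K) {z v u : H} (hv : φ v ≠ ⊤)
    (hu : ∀ d, ⟪d, u⟫ = ⟪B d, B (z - v)⟫)
    (hmin : ∀ v', φ v + ((1 / 2 * ‖B (z - v)‖ ^ 2 : ℝ) : EReal)
      ≤ φ v' + ((1 / 2 * ‖B (z - v')‖ ^ 2 : ℝ) : EReal)) :
    u ∈ esubdiff φ v := by
  intro y
  by_cases hy : φ y = ⊤
  · simp [hy]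
  obtain ⟨r, hr⟩ := exists_real_eq hbot hv
  obtain ⟨s, hs⟩ := exists_real_eq hbot hy
  have key : 0 ≤ s - r - ⟪y - v, u⟫ := by
    apply nonneg_of_forall_mul_add_sq_mul (b := 1 / 2 * ‖B (y - v)‖ ^ 2)
    intro t ht0 ht1
    have h1 := hmin ((1 - t) • v + t • y)
    have h2 := hφ v y (1 - t) t (by linarith) ht0.le (by ring)
    have h3 := h1.trans (add_le_add_left h2 _)
    rw [hr, hs] at h3
    norm_cast at h3
    have h4 : B (z - ((1 - t) • v + t • y)) = B (z - v) - t • B (y - v) := by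
      simp only [map_sub, map_add, map_smul]
      module
    rw [h4, norm_sub_sq_real, inner_smul_right, norm_smul, mul_pow, Real.norm_eq_abs,
      sq_abs] at h3
    rw [hu, real_inner_comm]
    linarith
  rw [hr, hs]
  norm_cast
  linarith

theorem add_half_norm_sq_le_of_mem_esubdiff {φ : H → EReal} (B : H →ₗ[ℝ] K) {z v u : H}
    (hu : ∀ d, ⟪d, u⟫ = ⟪B d, B (z - v)⟫) (h : u ∈ esubdiff φ v) (v' : H) :
    φ v + ((1 / 2 * ‖B (z - v)‖ ^ 2 + 1 / 2 * ‖B (v' - v)‖ ^ 2 : ℝ) : EReal)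
      ≤ φ v' + ((1 / 2 * ‖B (z - v')‖ ^ 2 : ℝ) : EReal) := by
  have h1 := add_le_add_left (h v') ((1 / 2 * ‖B (z - v')‖ ^ 2 : ℝ) : EReal)
  convert h1 using 1
  rw [add_assoc, ← EReal.coe_add]
  congr 2
  have h2 : B (z - v') = B (z - v) - B (v' - v) := by
    simp only [map_sub]
    abel
  rw [hu, h2, norm_sub_sq_real, real_inner_comm]
  ring

theorem eq_of_sub_mem_esubdiff_of_minimizer {φ : H → EReal} (hbot : ∀ z, φ z ≠ ⊥) {u v p : H}
    (hv : φ v ≠ ⊤) (h : u - v ∈ esubdiff φ v)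
    (hp : ∀ v', φ p + ((1 / 2 * ‖p - u‖ ^ 2 : ℝ) : EReal)
      ≤ φ v' + ((1 / 2 * ‖v' - u‖ ^ 2 : ℝ) : EReal)) :
    p = v := by
  have h1 := add_half_norm_sq_le_of_mem_esubdiff (LinearMap.id (R := ℝ) (M := H))
    (z := u) (fun d => rfl) h p
  have h2 := hp v
  rw [norm_sub_rev p u, norm_sub_rev v u] at h2
  have h3 := h1.trans h2
  obtain ⟨r, hr⟩ := exists_real_eq hbot hv
  rw [hr] at h3
  norm_cast at h3
  simp only [id] at h3
  have h4 : ‖p - v‖ ^ 2 ≤ 0 := by linarith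
  exact sub_eq_zero.mp (norm_eq_zero.mp (pow_eq_zero_iff two_ne_zero |>.mp
    (le_antisymm h4 (sq_nonneg _))))

theorem ECoercive.exists_minimizer [FiniteDimensional ℝ H] {φ : H → EReal}
    (hcoer : ECoercive φ) (hlsc : LowerSemicontinuous φ) (hbot : ∀ z, φ z ≠ ⊥)
    {v₀ : H} (hv₀ : φ v₀ ≠ ⊤) {g : H → ℝ} (hg : Continuous g) (hg0 : ∀ z, 0 ≤ g z) :
    ∃ v, ∀ v', φ v + (g v : EReal) ≤ φ v' + (g v' : EReal) := by
  obtain ⟨r, hr⟩ := exists_real_eq hbot hv₀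
  obtain ⟨R, hR⟩ := hcoer (r + g v₀)
  have hl : LowerSemicontinuous fun v => φ v + (g v : EReal) :=
    hlsc.add' (continuous_coe_real_ereal.comp hg).lowerSemicontinuous fun v =>
      EReal.continuousAt_add (Or.inr (EReal.coe_ne_bot _)) (Or.inr (EReal.coe_ne_top _))
  have hmem : v₀ ∈ Metric.closedBall (0 : H) (max R ‖v₀‖) := by simp
  obtain ⟨v, -, hv⟩ := LowerSemicontinuousOn.exists_isMinOn ⟨v₀, hmem⟩
    (isCompact_closedBall _ _) (hl.lowerSemicontinuousOn _)
  refine ⟨v, fun v' => ?_⟩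
  by_cases h : v' ∈ Metric.closedBall (0 : H) (max R ‖v₀‖)
  · exact hv h
  · have h1 : R ≤ ‖v'‖ := by
      simp only [mem_closedBall_zero_iff, not_le, max_lt_iff] at h
      exact h.1.le
    calc φ v + (g v : EReal) ≤ φ v₀ + (g v₀ : EReal) := hv hmem
      _ = ((r + g v₀ : ℝ) : EReal) := by rw [hr]; norm_cast
      _ ≤ φ v' := hR v' h1
      _ ≤ φ v' + (g v' : EReal) := le_add_of_nonneg_right (by exact_mod_cast hg0 v')

theorem fenchel_ne_bot {φ : H → EReal} {v₀ : H} (hv₀ : φ v₀ ≠ ⊤) (y : H) :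
    fenchel φ y ≠ ⊥ := by
  intro h
  have h1 : ((⟪v₀, y⟫ : ℝ) : EReal) - φ v₀ ≤ fenchel φ y :=
    le_iSup (fun v => ((⟪v, y⟫ : ℝ) : EReal) - φ v) v₀
  rw [h, le_bot_iff, sub_eq_add_neg, EReal.add_eq_bot_iff] at h1
  rcases h1 with h1 | h1
  · exact EReal.coe_ne_bot _ h1
  · exact hv₀ (by simpa using h1)

theorem fenchel_eq_of_mem_esubdiff {φ : H → EReal} {a w : H} {r : ℝ} (hr : φ a = r)
    (h : w ∈ esubdiff φ a) : fenchel φ w = ((⟪a, w⟫ - r : ℝ) : EReal) := by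
  apply le_antisymm
  · refine iSup_le fun v => ?_
    have h1 := h v
    rw [hr] at h1
    rw [EReal.sub_le_iff_le_add (Or.inr (EReal.coe_ne_top _)) (Or.inr (EReal.coe_ne_bot _))]
    refine le_trans (le_of_eq ?_) (add_le_add_right h1 _)
    norm_cast
    rw [inner_sub_left]
    ring
  · refine le_trans (le_of_eq ?_) (le_iSup _ a)
    rw [hr]
    norm_cast

theorem mem_esubdiff_fenchel {φ : H → EReal} {a w : H} {r : ℝ} (hr : φ a = r)
    (h : w ∈ esubdiff φ a) : a ∈ esubdiff (fenchel φ) w := by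
  intro w'
  rw [fenchel_eq_of_mem_esubdiff hr h]
  refine le_trans (le_of_eq ?_) (le_iSup _ a)
  rw [hr]
  norm_cast
  rw [inner_sub_left, real_inner_comm w' a, real_inner_comm w a]
  ring

/-- A proximal map of the conjugate fixes `w` at `a + w` exactly when `w` is a subgradient
at `a`. -/
theorem prox_fenchel_add_eq_iff [FiniteDimensional ℝ H] {φ : H → EReal} (hφ : EConvex φ)
    (hbot : ∀ z, φ z ≠ ⊥) (hlsc : LowerSemicontinuous φ) (hcoer : ECoercive φ)
    {v₀ : H} (hv₀ : φ v₀ ≠ ⊤) {prox : H → H}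
    (hprox : ∀ u w' : H,
      fenchel φ (prox u) + ((1 / 2 * ‖prox u - u‖ ^ 2 : ℝ) : EReal)
        ≤ fenchel φ w' + ((1 / 2 * ‖w' - u‖ ^ 2 : ℝ) : EReal)) {a w : H} :
    prox (a + w) = w ↔ φ a ≠ ⊤ ∧ w ∈ esubdiff φ a := by
  have key : ∀ {b y : H}, φ b ≠ ⊤ → y ∈ esubdiff φ b → prox (b + y) = y := by
    intro b y hb hy
    obtain ⟨r, hr⟩ := exists_real_eq hbot hb
    refine eq_of_sub_mem_esubdiff_of_minimizer (fenchel_ne_bot hv₀) ?_ ?_ (hprox _)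
    · rw [fenchel_eq_of_mem_esubdiff hr hy]
      exact EReal.coe_ne_top _
    · rw [add_sub_cancel_right]
      exact mem_esubdiff_fenchel hr hy
  refine ⟨fun h => ?_, fun h => key h.1 h.2⟩
  obtain ⟨p, hp⟩ := hcoer.exists_minimizer hlsc hbot hv₀
    (g := fun v => 1 / 2 * ‖(LinearMap.id (R := ℝ) (M := H)) (a + w - v)‖ ^ 2)
    (by simp only [LinearMap.id_apply]; fun_prop) (fun _ => by positivity)
  have hpt := ne_top_of_minimizer
    (g := fun v => 1 / 2 * ‖(LinearMap.id (R := ℝ) (M := H)) (a + w - v)‖ ^ 2) hv₀ hp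
  have hsub : a + w - p ∈ esubdiff φ p :=
    hφ.mem_esubdiff_of_minimizer hbot LinearMap.id hpt (fun d => rfl) hp
  have h1 := key hpt hsub
  rw [add_sub_cancel, h] at h1
  have h2 : p = a := by
    rw [eq_sub_iff_add_eq, add_comm] at h1
    exact add_right_cancel h1
  rw [h2, add_sub_cancel_left] at hsub
  exact ⟨h2 ▸ hpt, hsub⟩

theorem prox_const_mul_eq_iff {φ : H → EReal} (hφ : EConvex φ)
    (hbot : ∀ z, φ z ≠ ⊥) {v₀ : H} (hv₀ : φ v₀ ≠ ⊤) {c : ℝ} (hc : 0 < c) {prox : H → H}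
    (hprox : ∀ u v' : H,
      (c : EReal) * φ (prox u) + ((1 / 2 * ‖prox u - u‖ ^ 2 : ℝ) : EReal)
        ≤ (c : EReal) * φ v' + ((1 / 2 * ‖v' - u‖ ^ 2 : ℝ) : EReal)) {v d : H} :
    prox (v + c • d) = v ↔ φ v ≠ ⊤ ∧ d ∈ esubdiff φ v := by
  have hc' : (0 : EReal) < c := by exact_mod_cast hc
  have hcb : ∀ z, (c : EReal) * φ z ≠ ⊥ := by
    intro z
    by_cases hz : φ z = ⊤
    · simp [hz, EReal.mul_top_of_pos hc']
    · obtain ⟨r, hr⟩ := exists_real_eq hbot hz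
      rw [hr, ← EReal.coe_mul]
      exact EReal.coe_ne_bot _
  have hct : ∀ z, (c : EReal) * φ z ≠ ⊤ ↔ φ z ≠ ⊤ := by
    intro z
    by_cases hz : φ z = ⊤
    · simp [hz, EReal.mul_top_of_pos hc']
    · obtain ⟨r, hr⟩ := exists_real_eq hbot hz
      rw [hr, ← EReal.coe_mul]
      simp only [EReal.coe_ne_top, ne_eq, not_false_eq_true]
  have hsub : φ v ≠ ⊤ →
      (c • d ∈ esubdiff (fun z => (c : EReal) * φ z) v ↔ d ∈ esubdiff φ v) := by
    intro hv
    obtain ⟨r, hr⟩ := exists_real_eq hbot hv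
    refine forall_congr' fun y => ?_
    by_cases hy : φ y = ⊤
    · simp [hy, EReal.mul_top_of_pos hc']
    · obtain ⟨s, hs⟩ := exists_real_eq hbot hy
      simp only [hr, hs, inner_smul_right]
      norm_cast
      rw [← mul_add]
      exact mul_le_mul_iff_right₀ hc
  constructor
  · intro h
    have h1 := hprox (v + c • d)
    rw [h] at h1
    have hvt := ne_top_of_minimizer (φ := fun z => (c : EReal) * φ z)
      (g := fun z => 1 / 2 * ‖z - (v + c • d)‖ ^ 2) ((hct v₀).mpr hv₀) h1
    refine ⟨(hct v).mp hvt, (hsub ((hct v).mp hvt)).mp ?_⟩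
    refine (hφ.const_mul hc.le).mem_esubdiff_of_minimizer hcb LinearMap.id
      (z := v + c • d) hvt (fun d' => ?_) fun v' => ?_
    · simp
    · simpa only [LinearMap.id_apply, norm_sub_rev (v + c • d)] using h1 v'
  · rintro ⟨hv, hd⟩
    refine eq_of_sub_mem_esubdiff_of_minimizer hcb ((hct v).mpr hv) ?_ (hprox _)
    rw [add_sub_cancel_left]
    exact (hsub hv).mpr hd

theorem nearest_point_add_eq_iff {Δ : Set H} (hΔ : Convex ℝ Δ) {P : H → H}
    (hP : ∀ u, P u ∈ Δ ∧ ∀ q ∈ Δ, ‖u - P u‖ ≤ ‖u - q‖) {p z : H} :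
    P (p + z) = p ↔ p ∈ Δ ∧ ∀ q ∈ Δ, ⟪q - p, z⟫ ≤ 0 := by
  constructor
  · intro h
    have hp : p ∈ Δ := h ▸ (hP (p + z)).1
    refine ⟨hp, fun q hq => ?_⟩
    have key : 0 ≤ -⟪q - p, z⟫ := by
      apply nonneg_of_forall_mul_add_sq_mul (b := 1 / 2 * ‖q - p‖ ^ 2)
      intro t ht0 ht1
      have h1 := (hP (p + z)).2 _ (hΔ hp hq (by linarith : 0 ≤ 1 - t) ht0.le (by ring))
      have h2 : p + z - ((1 - t) • p + t • q) = z - t • (q - p) := by module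
      rw [h, add_sub_cancel_left, h2] at h1
      have h3 := pow_le_pow_left₀ (norm_nonneg _) h1 2
      rw [norm_sub_sq_real z, inner_smul_right, norm_smul, mul_pow, Real.norm_eq_abs,
        sq_abs] at h3
      rw [real_inner_comm]
      linarith
    linarith
  · rintro ⟨hp, h⟩
    have h1 := (hP (p + z)).2 p hp
    have h2 := h _ (hP (p + z)).1
    have h3 : p + z - P (p + z) = z - (P (p + z) - p) := by abel
    rw [h3, add_sub_cancel_left] at h1
    have h4 := pow_le_pow_left₀ (norm_nonneg _) h1 2
    rw [norm_sub_sq_real z, real_inner_comm] at h4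
    have h5 : ‖P (p + z) - p‖ ^ 2 ≤ 0 := by linarith
    exact sub_eq_zero.mp (norm_eq_zero.mp (pow_eq_zero_iff two_ne_zero |>.mp
      (le_antisymm h5 (sq_nonneg _))))

theorem mem_esubdiff_eindicator_iff {Δ : Set H} {p z : H} (hp : p ∈ Δ) :
    z ∈ esubdiff (eindicator Δ) p ↔ ∀ q ∈ Δ, ⟪q - p, z⟫ ≤ 0 := by
  refine forall_congr' fun q => ?_
  by_cases hq : q ∈ Δ
  · simp only [eindicator, hp, hq, if_true, zero_add, forall_const]
    norm_cast
  · simp [eindicator, hq]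

theorem tendsto_slope_inner_gradient [CompleteSpace H] {g : H → ℝ} {x : H}
    (hg : DifferentiableAt ℝ g x) (d : H) :
    Filter.Tendsto (fun t : ℝ => t⁻¹ * (g (x + t • d) - g x)) (nhdsWithin 0 (Set.Ioi 0))
      (nhds ⟪gradient g x, d⟫) := by
  have h := (hg.hasGradientAt.hasFDerivAt.hasLineDerivAt d).tendsto_slope_zero_right
  simpa using h

theorem ConvexOn.add_inner_gradient_le [CompleteSpace H] {g : H → ℝ}
    (hg : ConvexOn ℝ Set.univ g) {x : H} (hd : DifferentiableAt ℝ g x) (y : H) :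
    g x + ⟪gradient g x, y - x⟫ ≤ g y := by
  have h := le_of_tendsto (tendsto_slope_inner_gradient hd (y - x)) (b := g y - g x) (by
    filter_upwards [Ioc_mem_nhdsGT (zero_lt_one (α := ℝ))] with t ht
    have h1 := hg.2 (Set.mem_univ x) (Set.mem_univ y) (sub_nonneg.mpr ht.2) ht.1.le (by ring)
    have h2 : (1 - t) • x + t • y = x + t • (y - x) := by module
    rw [h2, smul_eq_mul, smul_eq_mul] at h1
    rw [inv_mul_le_iff₀ ht.1]
    linarith)
  linarith

end Subdifferential

section Cost

variable {X Y Z Z' : Type*}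
  [NormedAddCommGroup X] [InnerProductSpace ℝ X]
  [NormedAddCommGroup Y] [InnerProductSpace ℝ Y]
  [NormedAddCommGroup Z] [InnerProductSpace ℝ Z]
  [NormedAddCommGroup Z'] [InnerProductSpace ℝ Z']

theorem GME_eq_of_minimizer {Ψ : Z → EReal} {B : Z →ₗ[ℝ] Z'} {z v : Z} {p : ℝ}
    (hp : Ψ v = p)
    (hmin : ∀ v', Ψ v + ((1 / 2 * ‖B (z - v)‖ ^ 2 : ℝ) : EReal)
      ≤ Ψ v' + ((1 / 2 * ‖B (z - v')‖ ^ 2 : ℝ) : EReal)) :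
    GME Ψ B z = Ψ z - ((p + 1 / 2 * ‖B (z - v)‖ ^ 2 : ℝ) : EReal) := by
  have h : (⨅ v' : Z, (Ψ v' + ((1 / 2 * ‖B (z - v')‖ ^ 2 : ℝ) : EReal)))
      = Ψ v + ((1 / 2 * ‖B (z - v)‖ ^ 2 : ℝ) : EReal) :=
    le_antisymm (iInf_le _ v) (le_iInf hmin)
  rw [GME, h, hp, EReal.coe_add]

theorem Jcost_eq_coe {A : X →ₗ[ℝ] Y} {Lm : X →ₗ[ℝ] Z} {B : Z →ₗ[ℝ] Z'} {f : Y → ℝ}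
    {Ψ : Z → EReal} {μ : ℝ} {x : X} {v : Z} {p r : ℝ} (hp : Ψ v = p) (hr : Ψ (Lm x) = r)
    (hmin : ∀ v', Ψ v + ((1 / 2 * ‖B (Lm x - v)‖ ^ 2 : ℝ) : EReal)
      ≤ Ψ v' + ((1 / 2 * ‖B (Lm x - v')‖ ^ 2 : ℝ) : EReal)) :
    Jcost A Lm B f Ψ μ x
      = ((f (A x) + μ * (r - (p + 1 / 2 * ‖B (Lm x - v)‖ ^ 2)) : ℝ) : EReal) := by
  rw [Jcost, GME_eq_of_minimizer hp hmin, hr]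
  norm_cast

theorem Jcost_eq_top {A : X →ₗ[ℝ] Y} {Lm : X →ₗ[ℝ] Z} {B : Z →ₗ[ℝ] Z'} {f : Y → ℝ}
    {Ψ : Z → EReal} {μ : ℝ} (hμ : 0 < μ) {x : X} {v : Z} {p : ℝ} (hp : Ψ v = p)
    (hr : Ψ (Lm x) = ⊤)
    (hmin : ∀ v', Ψ v + ((1 / 2 * ‖B (Lm x - v)‖ ^ 2 : ℝ) : EReal)
      ≤ Ψ v' + ((1 / 2 * ‖B (Lm x - v')‖ ^ 2 : ℝ) : EReal)) :
    Jcost A Lm B f Ψ μ x = ⊤ := by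
  rw [Jcost, GME_eq_of_minimizer hp hmin, hr, EReal.top_sub_coe,
    EReal.mul_top_of_pos (by exact_mod_cast hμ), EReal.coe_add_top]

end Cost

section FixedPoint

variable {X Z Z' W : Type*}
  [NormedAddCommGroup X] [InnerProductSpace ℝ X] [FiniteDimensional ℝ X]
  [NormedAddCommGroup Z] [InnerProductSpace ℝ Z] [FiniteDimensional ℝ Z]
  [NormedAddCommGroup Z'] [InnerProductSpace ℝ Z'] [FiniteDimensional ℝ Z']
  [NormedAddCommGroup W] [InnerProductSpace ℝ W] [FiniteDimensional ℝ W]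

theorem minimizer_iff_mem_esubdiff {Ψ : Z → EReal} (hΨ : EConvex Ψ) (hbot : ∀ z, Ψ z ≠ ⊥)
    {v₀ : Z} (hv₀ : Ψ v₀ ≠ ⊤) {B : Z →ₗ[ℝ] Z'} {z v : Z} :
    (∀ v', Ψ v + ((1 / 2 * ‖B (z - v)‖ ^ 2 : ℝ) : EReal)
      ≤ Ψ v' + ((1 / 2 * ‖B (z - v')‖ ^ 2 : ℝ) : EReal)) ↔
    Ψ v ≠ ⊤ ∧ LinearMap.adjoint B (B (z - v)) ∈ esubdiff Ψ v := by
  have hu : ∀ d, ⟪d, LinearMap.adjoint B (B (z - v))⟫ = ⟪B d, B (z - v)⟫ := fun d =>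
    LinearMap.adjoint_inner_right B _ _
  constructor
  · intro h
    have hv := ne_top_of_minimizer (g := fun v => 1 / 2 * ‖B (z - v)‖ ^ 2) hv₀ h
    exact ⟨hv, hΨ.mem_esubdiff_of_minimizer hbot B hv hu h⟩
  · rintro ⟨-, h⟩ v'
    refine le_trans (add_le_add_right ?_ _) (add_half_norm_sq_le_of_mem_esubdiff B hu h v')
    exact_mod_cast le_add_of_nonneg_right (by positivity)

/-- The map sending `z` to `B v`, where `v` minimizes `Ψ + ‖B (z - ·)‖² / 2`, is nonexpansive
with respect to `B z`. -/
theorem norm_map_sub_le_of_mem_esubdiff {Ψ : Z → EReal} (hbot : ∀ z, Ψ z ≠ ⊥)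
    {B : Z →ₗ[ℝ] Z'} {z₁ z₂ v₁ v₂ : Z} (hv₁ : Ψ v₁ ≠ ⊤) (hv₂ : Ψ v₂ ≠ ⊤)
    (h₁ : LinearMap.adjoint B (B (z₁ - v₁)) ∈ esubdiff Ψ v₁)
    (h₂ : LinearMap.adjoint B (B (z₂ - v₂)) ∈ esubdiff Ψ v₂) :
    ‖B (v₂ - v₁)‖ ≤ ‖B (z₂ - z₁)‖ := by
  obtain ⟨p₁, hp₁⟩ := exists_real_eq hbot hv₁
  obtain ⟨p₂, hp₂⟩ := exists_real_eq hbot hv₂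
  have e₁ := h₁ v₂
  have e₂ := h₂ v₁
  rw [hp₁, hp₂, LinearMap.adjoint_inner_right] at e₁ e₂
  norm_cast at e₁ e₂
  have e₃ : B (z₂ - v₂) = B (z₁ - v₁) + B (z₂ - z₁) - B (v₂ - v₁) := by
    simp only [map_sub]
    abel
  rw [← neg_sub v₂ v₁, map_neg, e₃, inner_neg_left, inner_sub_right, inner_add_right,
    real_inner_self_eq_norm_sq] at e₂
  have e₄ := real_inner_le_norm (B (v₂ - v₁)) (B (z₂ - z₁))
  by_contra! hlt
  nlinarith [norm_nonneg (B (z₂ - z₁))]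

theorem mem_esubdiff_of_mem_esubdiff_Jcost {Y : Type*} [NormedAddCommGroup Y]
    [InnerProductSpace ℝ Y] {A : X →ₗ[ℝ] Y} {Lm : X →ₗ[ℝ] Z} {B : Z →ₗ[ℝ] Z'} {f : Y → ℝ}
    {Ψ : Z → EReal} (hbot : ∀ z, Ψ z ≠ ⊥) (hlsc : LowerSemicontinuous Ψ)
    (hconv : EConvex Ψ) (hcoer : ECoercive Ψ) {μ : ℝ} (hμ : 0 < μ) {x s : X} {v : Z}
    (hd : DifferentiableAt ℝ (fun x => f (A x) - μ / 2 * ‖B (Lm x)‖ ^ 2) x)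
    (hx : Ψ (Lm x) ≠ ⊤)
    (hv : ∀ v', Ψ v + ((1 / 2 * ‖B (Lm x - v)‖ ^ 2 : ℝ) : EReal)
      ≤ Ψ v' + ((1 / 2 * ‖B (Lm x - v')‖ ^ 2 : ℝ) : EReal))
    (hs : s ∈ esubdiff (Jcost A Lm B f Ψ μ) x) :
    μ⁻¹ • (s - gradient (fun x => f (A x) - μ / 2 * ‖B (Lm x)‖ ^ 2) x)
        - LinearMap.adjoint Lm (LinearMap.adjoint B (B v))
      ∈ esubdiff (fun x => Ψ (Lm x)) x := by
  intro y
  by_cases hy : Ψ (Lm y) = ⊤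
  · simp [hy]
  set g : X → ℝ := fun x => f (A x) - μ / 2 * ‖B (Lm x)‖ ^ 2 with hg
  obtain ⟨r, hr⟩ := exists_real_eq hbot hx
  obtain ⟨r', hr'⟩ := exists_real_eq hbot hy
  obtain ⟨hvt, hvsub⟩ := (minimizer_iff_mem_esubdiff hconv hbot hx).mp hv
  obtain ⟨p, hp⟩ := exists_real_eq hbot hvt
  set d := y - x with hdef
  have step : ∀ t : ℝ, 0 < t → t ≤ 1 →
      ⟪d, s⟫ ≤ t⁻¹ * (g (x + t • d) - g x) + μ * (r' - r) + μ * ⟪B (Lm d), B v⟫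
        + t * (μ * ‖B (Lm d)‖ ^ 2) := by
    intro t ht0 ht1
    obtain ⟨vt, hmin⟩ := hcoer.exists_minimizer hlsc hbot hx
      (g := fun v => 1 / 2 * ‖B (Lm (x + t • d) - v)‖ ^ 2)
      (by have := B.continuous_of_finiteDimensional; fun_prop) (fun _ => by positivity)
    obtain ⟨hvtt, hvtsub⟩ := (minimizer_iff_mem_esubdiff hconv hbot hx).mp hmin
    obtain ⟨pt, hpt⟩ := exists_real_eq hbot hvtt
    have hcomb : Lm (x + t • d) = (1 - t) • Lm x + t • Lm y := by
      simp only [hdef, map_add, map_smul, map_sub]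
      module
    have hΨt : Ψ (Lm (x + t • d)) ≤ (((1 - t) * r + t * r' : ℝ) : EReal) := by
      have h := hconv (Lm x) (Lm y) (1 - t) t (by linarith) ht0.le (by ring)
      rw [hr, hr', ← hcomb] at h
      exact_mod_cast h
    obtain ⟨rt, hrt⟩ := exists_real_eq hbot (ne_top_of_le_ne_top (EReal.coe_ne_top _) hΨt)
    rw [hrt, EReal.coe_le_coe_iff] at hΨt
    have hJ := hs (x + t • d)
    rw [Jcost_eq_coe hp hr hv, Jcost_eq_coe hpt hrt hmin, add_sub_cancel_left,
      real_inner_smul_left] at hJ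
    norm_cast at hJ
    have hvx := hv vt
    rw [hp, hpt] at hvx
    norm_cast at hvx
    have hne := norm_map_sub_le_of_mem_esubdiff hbot hvt hvtt hvsub hvtsub
    have e₁ : Lm (x + t • d) - Lm x = t • Lm d := by simp
    rw [e₁, map_smul, norm_smul, Real.norm_eq_abs, abs_of_pos ht0, map_sub B] at hne
    have hin : ⟪B (Lm d), B vt⟫ ≤ ⟪B (Lm d), B v⟫ + t * ‖B (Lm d)‖ ^ 2 := by
      have h1 := real_inner_le_norm (B (Lm d)) (B vt - B v)
      rw [inner_sub_right] at h1
      nlinarith [mul_le_mul_of_nonneg_left hne (norm_nonneg (B (Lm d)))]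
    have hgdef : g (x + t • d) - g x = f (A (x + t • d)) - f (A x)
        - μ / 2 * (‖B (Lm (x + t • d))‖ ^ 2 - ‖B (Lm x)‖ ^ 2) := by
      simp only [hg]
      ring
    have e₂ : ‖B (Lm (x + t • d) - vt)‖ ^ 2 - ‖B (Lm x - vt)‖ ^ 2
        = ‖B (Lm (x + t • d))‖ ^ 2 - ‖B (Lm x)‖ ^ 2 - 2 * (t * ⟪B (Lm d), B vt⟫) := by
      rw [map_sub, map_sub, norm_sub_sq_real, norm_sub_sq_real]
      simp only [map_add, map_smul, inner_add_left, real_inner_smul_left]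
      ring
    have m₁ := mul_le_mul_of_nonneg_left hΨt hμ.le
    have m₂ := mul_le_mul_of_nonneg_left hvx hμ.le
    have m₃ := mul_le_mul_of_nonneg_left hin (mul_pos hμ ht0).le
    have m₄ := congrArg (fun a => μ / 2 * a) e₂
    have hfin : t * ⟪d, s⟫ ≤ (g (x + t • d) - g x) + t * (μ * (r' - r)
        + μ * ⟪B (Lm d), B v⟫ + t * (μ * ‖B (Lm d)‖ ^ 2)) := by
      rw [hgdef]
      linarith
    have h5 : ⟪d, s⟫ ≤ t⁻¹ * ((g (x + t • d) - g x) + t * (μ * (r' - r)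
        + μ * ⟪B (Lm d), B v⟫ + t * (μ * ‖B (Lm d)‖ ^ 2))) := by
      rwa [le_inv_mul_iff₀ ht0]
    rw [mul_add, inv_mul_cancel_left₀ ht0.ne'] at h5
    linarith
  have hlim : ⟪d, s⟫ ≤ ⟪gradient g x, d⟫ + μ * (r' - r) + μ * ⟪B (Lm d), B v⟫
      + 0 * (μ * ‖B (Lm d)‖ ^ 2) := by
    refine ge_of_tendsto ((((tendsto_slope_inner_gradient hd d).add_const _).add_const _).add
      ((tendsto_nhdsWithin_of_tendsto_nhds Filter.tendsto_id).mul_const _)) ?_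
    filter_upwards [Ioc_mem_nhdsGT (zero_lt_one (α := ℝ))] with t ht
    exact step t ht.1 ht.2
  simp only [hr, hr']
  norm_cast
  rw [inner_sub_right, real_inner_smul_right, inner_sub_right, LinearMap.adjoint_inner_right,
    LinearMap.adjoint_inner_right, real_inner_comm (gradient g x)]
  have h6 : μ⁻¹ * (⟪d, s⟫ - ⟪gradient g x, d⟫) ≤ r' - r + ⟪B (Lm d), B v⟫ := by
    rw [inv_mul_le_iff₀ hμ]
    linarith
  linarith

theorem Tmap_eq_self_iff {Lm : X →ₗ[ℝ] Z} {B : Z →ₗ[ℝ] Z'} {Cm : X →ₗ[ℝ] W} {G : X → X}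
    {prox1 prox2 : Z → Z} {P : W → W} {μ σ τ : ℝ} (hσ : 0 < σ) {x : X} {v w : Z} {z : W} :
    Tmap Lm B Cm G prox1 prox2 P μ σ τ (x, v, w, z) = (x, v, w, z) ↔
      G x + μ • LinearMap.adjoint Lm (LinearMap.adjoint B (B v)) + μ • LinearMap.adjoint Lm w
          + μ • LinearMap.adjoint Cm z = 0 ∧
        prox1 (v + (μ / τ) • LinearMap.adjoint B (B (Lm x - v))) = v ∧
        prox2 (Lm x + w) = w ∧ P (Cm x + z) = Cm x := by
  have hξ : x - (1 / σ) • G x - (μ / σ) • LinearMap.adjoint Lm (LinearMap.adjoint B (B v))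
      - (μ / σ) • LinearMap.adjoint Lm w - (μ / σ) • LinearMap.adjoint Cm z
      = x - (1 / σ) • (G x + μ • LinearMap.adjoint Lm (LinearMap.adjoint B (B v))
        + μ • LinearMap.adjoint Lm w + μ • LinearMap.adjoint Cm z) := by
    simp only [smul_add, smul_smul, div_eq_mul_inv, one_mul, mul_comm σ⁻¹]
    abel
  have h1 : (2 * μ / τ) • LinearMap.adjoint B (B (Lm x)) - (μ / τ) • LinearMap.adjoint B (B (Lm x))
      + (v - (μ / τ) • LinearMap.adjoint B (B v))
      = v + (μ / τ) • LinearMap.adjoint B (B (Lm x - v)) := by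
    simp only [map_sub]
    module
  have h2 : (2 : ℝ) • Lm x - Lm x + w = Lm x + w := by module
  have h3 : (2 : ℝ) • Cm x - Cm x + z = Cm x + z := by module
  simp only [Tmap, Prod.mk.injEq, hξ]
  rw [sub_eq_self, smul_eq_zero_iff_right (one_div_pos.mpr hσ).ne']
  refine and_congr_right fun h0 => ?_
  rw [h0, smul_zero, sub_zero, h1, h2, h3]
  refine and_congr_right fun _ => and_congr_right fun _ => ?_
  constructor
  · intro h
    rw [sub_eq_iff_eq_add, add_comm z] at h
    exact (add_right_cancel h).symm
  · intro h
    rw [h, add_sub_cancel_left]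

end FixedPoint

theorem stmt17
    {X Y Z Z' W : Type*}
    [NormedAddCommGroup X] [InnerProductSpace ℝ X] [FiniteDimensional ℝ X]
    [NormedAddCommGroup Y] [InnerProductSpace ℝ Y] [FiniteDimensional ℝ Y]
    [NormedAddCommGroup Z] [InnerProductSpace ℝ Z] [FiniteDimensional ℝ Z]
    [NormedAddCommGroup Z'] [InnerProductSpace ℝ Z'] [FiniteDimensional ℝ Z']
    [NormedAddCommGroup W] [InnerProductSpace ℝ W] [FiniteDimensional ℝ W]
    (A : X →ₗ[ℝ] Y) (Lm : X →ₗ[ℝ] Z) (B : Z →ₗ[ℝ] Z') (Cm : X →ₗ[ℝ] W)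
    (f : Y → ℝ) (hf : ConvexOn ℝ Set.univ f)
    (Ψ : Z → EReal) (hΨbot : ∀ z : Z, Ψ z ≠ ⊥) (hΨlsc : LowerSemicontinuous Ψ)
    (hΨconv : EConvex Ψ) (hΨcoer : ECoercive Ψ)
    (μ : ℝ) (hμ : 0 < μ)
    (Δ : Set W) (hΔne : Δ.Nonempty) (hΔcl : IsClosed Δ) (hΔcv : Convex ℝ Δ)
    (hfeas : ∃ x : X, Ψ (Lm x) ≠ ⊤ ∧ Cm x ∈ Δ)
    (hC1 : ConvexOn ℝ Set.univ (fun x : X => f (A x) - μ / 2 * ‖B (Lm x)‖ ^ 2))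
    (hfdiff : Differentiable ℝ f) (Lf : ℝ) (hLf : 0 < Lf)
    (hflip : ∀ y₁ y₂ : Y, ‖gradient f y₁ - gradient f y₂‖ ≤ Lf * ‖y₁ - y₂‖)
    (hsol : ∃ xs : X, Cm xs ∈ Δ ∧
      ∀ x : X, Cm x ∈ Δ → Jcost A Lm B f Ψ μ xs ≤ Jcost A Lm B f Ψ μ x)
    (hsum : ∀ x : X,
      esubdiff (fun x' : X => Jcost A Lm B f Ψ μ x' + eindicator Δ (Cm x')) x
        = esubdiff (Jcost A Lm B f Ψ μ) x
          + esubdiff (fun x' : X => eindicator Δ (Cm x')) x)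
    (hchainΨ : ∀ x : X,
      esubdiff (fun x' : X => Ψ (Lm x')) x = LinearMap.adjoint Lm '' esubdiff Ψ (Lm x))
    (hchainΔ : ∀ x : X,
      esubdiff (fun x' : X => eindicator Δ (Cm x')) x
        = LinearMap.adjoint Cm '' esubdiff (eindicator Δ) (Cm x))
    (prox1 prox2 : Z → Z) (PΔ : W → W) (σ τ : ℝ)
    (hprox1 : ∀ u v' : Z,
      ((μ / τ : ℝ) : EReal) * Ψ (prox1 u)
          + ((((1 : ℝ) / 2) * ‖prox1 u - u‖ ^ 2 : ℝ) : EReal)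
        ≤ ((μ / τ : ℝ) : EReal) * Ψ v' + ((((1 : ℝ) / 2) * ‖v' - u‖ ^ 2 : ℝ) : EReal))
    (hprox2 : ∀ u w' : Z,
      fenchel Ψ (prox2 u) + ((((1 : ℝ) / 2) * ‖prox2 u - u‖ ^ 2 : ℝ) : EReal)
        ≤ fenchel Ψ w' + ((((1 : ℝ) / 2) * ‖w' - u‖ ^ 2 : ℝ) : EReal))
    (hPΔ : ∀ u : W, PΔ u ∈ Δ ∧ ∀ q ∈ Δ, ‖u - PΔ u‖ ≤ ‖u - q‖)
    (hσ : 0 < σ) (hτ : 0 < τ) :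
    {x : X | Cm x ∈ Δ ∧ ∀ x' : X, Cm x' ∈ Δ → Jcost A Lm B f Ψ μ x ≤ Jcost A Lm B f Ψ μ x'}
      = {x : X | ∃ (v w : Z) (z : W),
          Tmap Lm B Cm (gradient (fun x'' : X => f (A x'') - μ / 2 * ‖B (Lm x'')‖ ^ 2))
            prox1 prox2 PΔ μ σ τ (x, v, w, z) = (x, v, w, z)} := by

  obtain ⟨x₀, hx₀, hx₀Δ⟩ := hfeas
  have hB := B.continuous_of_finiteDimensional
  have hd : Differentiable ℝ fun x => f (A x) - μ / 2 * ‖B (Lm x)‖ ^ 2 := by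
    have hA : Differentiable ℝ A := (LinearMap.toContinuousLinearMap A).differentiable
    have hBL : Differentiable ℝ fun x => B (Lm x) :=
      (LinearMap.toContinuousLinearMap (B ∘ₗ Lm)).differentiable
    exact (hfdiff.comp hA).sub ((hBL.norm_sq ℝ).const_mul _)
  have hM : ∀ z, ∃ v, ∀ v', Ψ v + ((1 / 2 * ‖B (z - v)‖ ^ 2 : ℝ) : EReal)
      ≤ Ψ v' + ((1 / 2 * ‖B (z - v')‖ ^ 2 : ℝ) : EReal) := fun z =>
    hΨcoer.exists_minimizer hΨlsc hΨbot hx₀ (g := fun v => 1 / 2 * ‖B (z - v)‖ ^ 2)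
      (by fun_prop) (fun _ => by positivity)
  have hMt : ∀ {z v}, (∀ v', Ψ v + ((1 / 2 * ‖B (z - v)‖ ^ 2 : ℝ) : EReal)
      ≤ Ψ v' + ((1 / 2 * ‖B (z - v')‖ ^ 2 : ℝ) : EReal)) → ∃ p : ℝ, Ψ v = p := fun h =>
    exists_real_eq hΨbot ((minimizer_iff_mem_esubdiff hΨconv hΨbot hx₀).mp h).1
  ext x
  simp only [Set.mem_ofPred_eq, Tmap_eq_self_iff hσ,
    prox_const_mul_eq_iff hΨconv hΨbot hx₀ (div_pos hμ hτ) hprox1,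
    prox_fenchel_add_eq_iff hΨconv hΨbot hΨlsc hΨcoer hx₀ hprox2,
    nearest_point_add_eq_iff hΔcv hPΔ, ← minimizer_iff_mem_esubdiff hΨconv hΨbot hx₀]
  constructor
  · rintro ⟨hxΔ, hxmin⟩
    obtain ⟨v, hv⟩ := hM (Lm x)
    have hx : Ψ (Lm x) ≠ ⊤ := by
      intro htop
      obtain ⟨p, hp⟩ := hMt hv
      obtain ⟨v₀, hv₀⟩ := hM (Lm x₀)
      obtain ⟨p₀, hp₀⟩ := hMt hv₀
      obtain ⟨r₀, hr₀⟩ := exists_real_eq hΨbot hx₀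
      have h := hxmin x₀ hx₀Δ
      rw [Jcost_eq_top hμ hp htop hv, Jcost_eq_coe hp₀ hr₀ hv₀, top_le_iff] at h
      exact EReal.coe_ne_top _ h
    have hJbot : ∀ y, Jcost A Lm B f Ψ μ y ≠ ⊥ := by
      intro y
      obtain ⟨vy, hvy⟩ := hM (Lm y)
      obtain ⟨p, hp⟩ := hMt hvy
      by_cases hy : Ψ (Lm y) = ⊤
      · rw [Jcost_eq_top hμ hp hy hvy]
        exact top_ne_bot
      · obtain ⟨r, hr⟩ := exists_real_eq hΨbot hy
        rw [Jcost_eq_coe hp hr hvy]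
        exact EReal.coe_ne_bot _
    have h0 : (0 : X) ∈
        esubdiff (fun x' : X => Jcost A Lm B f Ψ μ x' + eindicator Δ (Cm x')) x := by
      intro y
      by_cases hy : Cm y ∈ Δ
      · simpa [eindicator, hxΔ, hy] using hxmin y hy
      · simp [eindicator, hy, EReal.add_top_of_ne_bot (hJbot y)]
    rw [hsum, hchainΔ] at h0
    obtain ⟨s, hs, -, ⟨z, hz, rfl⟩, hsz⟩ := Set.mem_add.mp h0
    have hw := mem_esubdiff_of_mem_esubdiff_Jcost hΨbot hΨlsc hΨconv hΨcoer hμ (hd x) hx hv hs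
    rw [hchainΨ] at hw
    obtain ⟨w, hw, hLw⟩ := hw
    refine ⟨v, w, μ⁻¹ • z, ?_, hv, ⟨hx, hw⟩, hxΔ, fun q hq => ?_⟩
    · rw [hLw, eq_neg_of_add_eq_zero_left hsz, map_smul, smul_sub, smul_inv_smul₀ hμ.ne',
        smul_inv_smul₀ hμ.ne']
      abel
    · rw [real_inner_smul_right]
      exact mul_nonpos_of_nonneg_of_nonpos (inv_nonneg.mpr hμ.le)
        ((mem_esubdiff_eindicator_iff hxΔ).mp hz q hq)
  · rintro ⟨v, w, z, hG, hv, ⟨hx, hw⟩, hxΔ, hz⟩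
    refine ⟨hxΔ, fun y hyΔ => ?_⟩
    obtain ⟨p, hp⟩ := hMt hv
    obtain ⟨vy, hvy⟩ := hM (Lm y)
    obtain ⟨py, hpy⟩ := hMt hvy
    by_cases hy : Ψ (Lm y) = ⊤
    · rw [Jcost_eq_top hμ hpy hy hvy]
      exact le_top
    obtain ⟨r, hr⟩ := exists_real_eq hΨbot hx
    obtain ⟨ry, hry⟩ := exists_real_eq hΨbot hy
    rw [Jcost_eq_coe hp hr hv, Jcost_eq_coe hpy hry hvy, EReal.coe_le_coe_iff]
    have e₁ := hC1.add_inner_gradient_le (hd x) y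
    have e₂ := hw (Lm y)
    rw [hr, hry] at e₂
    norm_cast at e₂
    have e₃ := hvy v
    rw [hp, hpy] at e₃
    norm_cast at e₃
    have e₄ := hz _ hyΔ
    have e₅ := congrArg (fun a => ⟪y - x, a⟫) hG
    simp only [inner_add_right, real_inner_smul_right, LinearMap.adjoint_inner_right,
      inner_zero_right, map_sub Lm, map_sub Cm] at e₅
    rw [real_inner_comm] at e₁
    have e₆ : ‖B (Lm y - v)‖ ^ 2 - ‖B (Lm x - v)‖ ^ 2
        = ‖B (Lm y)‖ ^ 2 - ‖B (Lm x)‖ ^ 2 - 2 * ⟪B (Lm y - Lm x), B v⟫ := by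
      rw [map_sub, map_sub, map_sub, norm_sub_sq_real, norm_sub_sq_real, inner_sub_left]
      ring
    have m₂ := mul_le_mul_of_nonneg_left e₂ hμ.le
    have m₃ := mul_le_mul_of_nonneg_left e₃ hμ.le
    have m₄ := mul_le_mul_of_nonneg_left e₄ hμ.le
    have m₆ := congrArg (fun a => μ / 2 * a) e₆
    linarith
end
end

section
/- Let m ∈ ℕ. For each i ∈ {1,…,m}, let Π_i ⊂ ℝ be a nonempty closed interval with endpoints l_i := inf Π_i ∈ [−∞, ∞) and h_i := sup Π_i ∈ (−∞, ∞], and let 𝔣_i : ℝ → (−∞,∞] be proper lower semicontinuous convex and twice continuously differentiable on Π_i with sup_{t∈Π_i} 𝔣_i''(t) < ∞. Let r : ℝ → ℝ be twice continuously differentiable with r''(t) ≥ 0 for all t, sup_{t∈ℝ} r''(t) < ∞, and r(0) = r'(0) = r''(0) = 0. Define f̃_i : ℝ → ℝ by f̃_i(t) := (𝔣_i''(l_i)/2)(t − l_i)² + 𝔣_i'(l_i)(t − l_i) + 𝔣_i(l_i) + r(l_i − t) for t ≤ l_i (this branch is vacuous when l_i = −∞), f̃_i(t) := 𝔣_i(t)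 for l_i < t < h_i, and f̃_i(t) := (𝔣_i''(h_i)/2)(t − h_i)² + 𝔣_i'(h_i)(t − h_i) + 𝔣_i(h_i) + r(t − h_i) for t ≥ h_i (vacuous when h_i = ∞), and set f̃(u) := Σ_{i=1}^m f̃_i(u_i) for u ∈ ℝ^m. Then: (a) f̃ is twice continuously differentiable on ℝ^m and ∇f̃ is Lipschitz continuous with constant max{sup_{t∈Π_1} 𝔣_1''(t), …, sup_{t∈Π_m} 𝔣_m''(t)} + sup_{t∈ℝ} r''(t); and (b) the function u ↦ f̃(u) − (1/2)⟨Λu, u⟩ is convex, where Λ is the diagonal m×m matrix with Λ_{ii} := inf_{t∈Π_i} 𝔣_i''(t) ≥ 0. -/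
open scoped Pointwise RealInnerProductSpace

noncomputable section

/- The smooth extension `f̃_i` built from the pieces of `𝔣_i` on `Π_i`:
quadratic (plus `r`) extrapolation below `l_i = inf Π_i` and above `h_i = sup Π_i`.
Note `t ≤ l_i ↔ t ∈ lowerBounds Π_i` and `t ≥ h_i ↔ t ∈ upperBounds Π_i`.
-/
open Classical in
noncomputable def extPiece (Pi_ : Set ℝ) (F F' F'' : ℝ → ℝ) (r : ℝ → ℝ) (t : ℝ) : ℝ :=
  if t ∈ lowerBounds Pi_ then
    F'' (sInf Pi_) / 2 * (t - sInf Pi_) ^ 2 + F' (sInf Pi_) * (t - sInf Pi_) + F (sInf Pi_)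
      + r (sInf Pi_ - t)
  else if t ∈ upperBounds Pi_ then
    F'' (sSup Pi_) / 2 * (t - sSup Pi_) ^ 2 + F' (sSup Pi_) * (t - sSup Pi_) + F (sSup Pi_)
      + r (t - sSup Pi_)
  else F t

open Classical in
/-- The function equal to `a` below `S`, to `b` above `S`, and to `c` elsewhere. -/
def glueOutside {β : Type*} (S : Set ℝ) (a b c : ℝ → β) (t : ℝ) : β :=
  if t ∈ lowerBounds S then a t else if t ∈ upperBounds S then b t else c t

lemma mem_of_mem_lowerBounds_of_mem_upperBounds {S : Set ℝ} (hS : S.Nonempty) {t : ℝ}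
    (hl : t ∈ lowerBounds S) (hu : t ∈ upperBounds S) : t ∈ S := by
  obtain ⟨s, hs⟩ := hS
  rwa [le_antisymm (hl hs) (hu hs)]

lemma mem_lowerBounds_or_mem_or_mem_upperBounds {S : Set ℝ} (hS : S.OrdConnected) (t : ℝ) :
    t ∈ lowerBounds S ∨ t ∈ S ∨ t ∈ upperBounds S := by
  by_contra! h
  obtain ⟨hl, ht, hu⟩ := h
  simp only [mem_lowerBounds, mem_upperBounds, not_forall, not_le] at hl hu
  obtain ⟨x, hx, hxt⟩ := hl
  obtain ⟨y, hy, hyt⟩ := hu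
  exact ht (hS.out hx hy ⟨hxt.le, hyt.le⟩)

lemma isClosed_lowerBounds_real (S : Set ℝ) : IsClosed (lowerBounds S) := by
  have : lowerBounds S = ⋂ s ∈ S, Set.Iic s := by
    ext t
    simp [mem_lowerBounds]
  rw [this]
  exact isClosed_biInter fun _ _ => isClosed_Iic

lemma isClosed_upperBounds_real (S : Set ℝ) : IsClosed (upperBounds S) := by
  have : upperBounds S = ⋂ s ∈ S, Set.Ici s := by
    ext t
    simp [mem_upperBounds]
  rw [this]
  exact isClosed_biInter fun _ _ => isClosed_Ici

section Glue

variable {β : Type*} {S : Set ℝ} {a b c : ℝ → β}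

lemma glueOutside_of_mem_lowerBounds {t : ℝ} (ht : t ∈ lowerBounds S) :
    glueOutside S a b c t = a t := if_pos ht

lemma glueOutside_of_mem (ha : ∀ t ∈ lowerBounds S, t ∈ S → a t = c t)
    (hb : ∀ t ∈ upperBounds S, t ∈ S → b t = c t) {t : ℝ} (ht : t ∈ S) :
    glueOutside S a b c t = c t := by
  unfold glueOutside
  split_ifs with h₁ h₂
  · exact ha t h₁ ht
  · exact hb t h₂ ht
  · rfl

lemma glueOutside_of_mem_upperBounds (hS : S.Nonempty)
    (ha : ∀ t ∈ lowerBounds S, t ∈ S → a t = c t)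
    (hb : ∀ t ∈ upperBounds S, t ∈ S → b t = c t) {t : ℝ} (ht : t ∈ upperBounds S) :
    glueOutside S a b c t = b t := by
  by_cases h : t ∈ lowerBounds S
  · have hm := mem_of_mem_lowerBounds_of_mem_upperBounds hS h ht
    rw [glueOutside_of_mem ha hb hm, hb t ht hm]
  · rw [glueOutside, if_neg h, if_pos ht]

lemma continuous_glueOutside [TopologicalSpace β] (hS : S.Nonempty) (hcl : IsClosed S)
    (hord : S.OrdConnected)
    (ha : ∀ t ∈ lowerBounds S, t ∈ S → a t = c t)
    (hb : ∀ t ∈ upperBounds S, t ∈ S → b t = c t)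
    (hac : Continuous a) (hbc : Continuous b) (hcc : ContinuousOn c S) :
    Continuous (glueOutside S a b c) := by
  have h₁ : ContinuousOn (glueOutside S a b c) (lowerBounds S) :=
    hac.continuousOn.congr fun t ht => glueOutside_of_mem_lowerBounds ht
  have h₂ : ContinuousOn (glueOutside S a b c) S :=
    hcc.congr fun t ht => glueOutside_of_mem ha hb ht
  have h₃ : ContinuousOn (glueOutside S a b c) (upperBounds S) :=
    hbc.continuousOn.congr fun t ht => glueOutside_of_mem_upperBounds hS ha hb ht
  have h := h₁.union_of_isClosed (h₂.union_of_isClosed h₃ hcl (isClosed_upperBounds_real S))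
    (isClosed_lowerBounds_real S) (hcl.union (isClosed_upperBounds_real S))
  rw [← continuousOn_univ]
  exact h.mono fun t _ => mem_lowerBounds_or_mem_or_mem_upperBounds hord t

end Glue

lemma hasDerivAt_glueOutside {S : Set ℝ} {a b c a' b' c' : ℝ → ℝ} (hS : S.Nonempty)
    (hcl : IsClosed S) (hord : S.OrdConnected)
    (ha : ∀ t ∈ lowerBounds S, t ∈ S → a t = c t)
    (hb : ∀ t ∈ upperBounds S, t ∈ S → b t = c t)
    (ha' : ∀ t ∈ lowerBounds S, t ∈ S → a' t = c' t)
    (hb' : ∀ t ∈ upperBounds S, t ∈ S → b' t = c' t)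
    (hda : ∀ t, HasDerivAt a (a' t) t) (hdb : ∀ t, HasDerivAt b (b' t) t)
    (hdc : ∀ t ∈ S, HasDerivWithinAt c (c' t) S t) (t : ℝ) :
    HasDerivAt (glueOutside S a b c) (glueOutside S a' b' c' t) t := by
  have h₁ : HasDerivWithinAt (glueOutside S a b c) (glueOutside S a' b' c' t)
      (lowerBounds S) t := by
    by_cases ht : t ∈ lowerBounds S
    · rw [glueOutside_of_mem_lowerBounds ht]
      exact (hda t).hasDerivWithinAt.congr_of_mem
        (fun s hs => glueOutside_of_mem_lowerBounds hs) ht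
    · exact hasDerivWithinAt_iff_hasFDerivWithinAt.2
        (.of_notMem_closure (by rwa [(isClosed_lowerBounds_real S).closure_eq]))
  have h₂ : HasDerivWithinAt (glueOutside S a b c) (glueOutside S a' b' c' t) S t := by
    by_cases ht : t ∈ S
    · rw [glueOutside_of_mem ha' hb' ht]
      exact (hdc t ht).congr_of_mem (fun s hs => glueOutside_of_mem ha hb hs) ht
    · exact hasDerivWithinAt_iff_hasFDerivWithinAt.2
        (.of_notMem_closure (by rwa [hcl.closure_eq]))
  have h₃ : HasDerivWithinAt (glueOutside S a b c) (glueOutside S a' b' c' t)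
      (upperBounds S) t := by
    by_cases ht : t ∈ upperBounds S
    · rw [glueOutside_of_mem_upperBounds hS ha' hb' ht]
      exact (hdb t).hasDerivWithinAt.congr_of_mem
        (fun s hs => glueOutside_of_mem_upperBounds hS ha hb hs) ht
    · exact hasDerivWithinAt_iff_hasFDerivWithinAt.2
        (.of_notMem_closure (by rwa [(isClosed_upperBounds_real S).closure_eq]))
  rw [← hasDerivWithinAt_univ]
  exact (h₁.union (h₂.union h₃)).mono
    fun s _ => mem_lowerBounds_or_mem_or_mem_upperBounds hord s

lemma exists_deriv_extPiece {S : Set ℝ} (hS : S.Nonempty) (hcl : IsClosed S)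
    (hord : S.OrdConnected) {F F' F'' : ℝ → ℝ}
    (hF' : ∀ t ∈ S, HasDerivWithinAt F (F' t) S t)
    (hF'' : ∀ t ∈ S, HasDerivWithinAt F' (F'' t) S t)
    (hF''cont : ContinuousOn F'' S) (hF''below : BddBelow (F'' '' S))
    (hF''bdd : BddAbove (F'' '' S))
    {r : ℝ → ℝ} (hr : ContDiff ℝ 2 r) (hr''nonneg : ∀ t : ℝ, 0 ≤ deriv (deriv r) t)
    (hr''bdd : BddAbove (Set.range (deriv (deriv r))))
    (hr0 : r 0 = 0) (hr'0 : deriv r 0 = 0) (hr''0 : deriv (deriv r) 0 = 0) :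
    ∃ g' g'' : ℝ → ℝ, (∀ t, HasDerivAt (extPiece S F F' F'' r) (g' t) t) ∧
      (∀ t, HasDerivAt g' (g'' t) t) ∧ Continuous g'' ∧
      ∀ t, sInf (F'' '' S) ≤ g'' t ∧
        g'' t ≤ sSup (F'' '' S) + sSup (Set.range (deriv (deriv r))) := by
  have hr1 : ContDiff ℝ 1 (deriv r) := ((contDiff_succ_iff_deriv (n := 1)).1 hr).2.2
  have hd : ∀ t, HasDerivAt r (deriv r t) t := fun t =>
    (hr.differentiable (by norm_num) t).hasDerivAt
  have hdd : ∀ t, HasDerivAt (deriv r) (deriv (deriv r) t) t := fun t =>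
    (hr1.differentiable (by norm_num) t).hasDerivAt
  have hddc : Continuous (deriv (deriv r)) := hr1.continuous_deriv le_rfl
  have hl : ∀ t ∈ lowerBounds S, t ∈ S → sInf S = t := fun t h h' =>
    IsLeast.csInf_eq ⟨h', h⟩
  have hu : ∀ t ∈ upperBounds S, t ∈ S → sSup S = t := fun t h h' =>
    IsGreatest.csSup_eq ⟨h', h⟩
  set l := sInf S with hl_def
  set h := sSup S with hh_def
  set a'' : ℝ → ℝ := fun t => F'' l + deriv (deriv r) (l - t) with ha''_def
  set b'' : ℝ → ℝ := fun t => F'' h + deriv (deriv r) (t - h) with hb''_def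
  have ha'' : ∀ t ∈ lowerBounds S, t ∈ S → a'' t = F'' t := fun t h₁ h₂ => by
    simp [ha''_def, hl t h₁ h₂, hr''0]
  have hb'' : ∀ t ∈ upperBounds S, t ∈ S → b'' t = F'' t := fun t h₁ h₂ => by
    simp [hb''_def, hu t h₁ h₂, hr''0]
  have ha' : ∀ t ∈ lowerBounds S, t ∈ S →
      F'' l * (t - l) + F' l - deriv r (l - t) = F' t := fun t h₁ h₂ => by
    simp [hl t h₁ h₂, hr'0]
  have hb' : ∀ t ∈ upperBounds S, t ∈ S →
      F'' h * (t - h) + F' h + deriv r (t - h) = F' t := fun t h₁ h₂ => by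
    simp [hu t h₁ h₂, hr'0]
  refine ⟨glueOutside S (fun t => F'' l * (t - l) + F' l - deriv r (l - t))
    (fun t => F'' h * (t - h) + F' h + deriv r (t - h)) F',
    glueOutside S a'' b'' F'', ?_, ?_, ?_, ?_⟩
  · refine hasDerivAt_glueOutside (S := S) (c := F) hS hcl hord ?_ ?_ ha' hb' ?_ ?_ hF'
    · intro t h₁ h₂
      simp [← hl_def, hl t h₁ h₂, hr0]
    · intro t h₁ h₂
      simp [← hh_def, hu t h₁ h₂, hr0]
    · intro t
      have e : HasDerivAt (fun t => t - l) 1 t := (hasDerivAt_id t).sub_const l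
      have e' : HasDerivAt (fun t => l - t) (-1) t := (hasDerivAt_id t).const_sub l
      refine (((((e.pow 2).const_mul (F'' l / 2)).add (e.const_mul (F' l))).add_const (F l)).add
        ((hd (l - t)).comp t e')).congr_deriv ?_
      push_cast
      ring
    · intro t
      have e : HasDerivAt (fun t => t - h) 1 t := (hasDerivAt_id t).sub_const h
      refine (((((e.pow 2).const_mul (F'' h / 2)).add (e.const_mul (F' h))).add_const (F h)).add
        ((hd (t - h)).comp t e)).congr_deriv ?_
      push_cast
      ring
  · refine hasDerivAt_glueOutside hS hcl hord ha' hb' ha'' hb'' ?_ ?_ hF''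
    · intro t
      have e : HasDerivAt (fun t => t - l) 1 t := (hasDerivAt_id t).sub_const l
      have e' : HasDerivAt (fun t => l - t) (-1) t := (hasDerivAt_id t).const_sub l
      refine (((e.const_mul (F'' l)).add_const (F' l)).sub
        ((hdd (l - t)).comp t e')).congr_deriv ?_
      simp [ha''_def]
    · intro t
      have e : HasDerivAt (fun t => t - h) 1 t := (hasDerivAt_id t).sub_const h
      refine (((e.const_mul (F'' h)).add_const (F' h)).add
        ((hdd (t - h)).comp t e)).congr_deriv ?_
      simp [hb''_def]
  · exact continuous_glueOutside hS hcl hord ha'' hb''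
      (continuous_const.add (hddc.comp (by fun_prop)))
      (continuous_const.add (hddc.comp (by fun_prop))) hF''cont
  · intro t
    have hle : ∀ s ∈ S, ∀ x, sInf (F'' '' S) ≤ F'' s + deriv (deriv r) x ∧
        F'' s + deriv (deriv r) x ≤ sSup (F'' '' S) + sSup (Set.range (deriv (deriv r))) := by
      intro s hs x
      have h₁ := csInf_le hF''below (Set.mem_image_of_mem F'' hs)
      have h₂ := le_csSup hF''bdd (Set.mem_image_of_mem F'' hs)
      have h₃ := le_csSup hr''bdd (Set.mem_range_self x)
      have h₄ := hr''nonneg x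
      constructor <;> linarith
    rcases mem_lowerBounds_or_mem_or_mem_upperBounds hord t with ht | ht | ht
    · rw [glueOutside_of_mem_lowerBounds ht]
      exact hle l (hcl.csInf_mem hS ⟨t, ht⟩) _
    · rw [glueOutside_of_mem ha'' hb'' ht]
      simpa [hr''0] using hle t ht 0
    · rw [glueOutside_of_mem_upperBounds hS ha'' hb'' ht]
      exact hle h (hcl.csSup_mem hS ⟨t, ht⟩) _

section Separable

variable {ι : Type*} [Fintype ι] {g g' : ι → ℝ → ℝ}

lemma contDiff_two_of_hasDerivAt {g g' g'' : ℝ → ℝ} (h₁ : ∀ t, HasDerivAt g (g' t) t)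
    (h₂ : ∀ t, HasDerivAt g' (g'' t) t) (h₃ : Continuous g'') : ContDiff ℝ 2 g := by
  have e₁ : deriv g = g' := funext fun t => (h₁ t).deriv
  have e₂ : deriv g' = g'' := funext fun t => (h₂ t).deriv
  refine (contDiff_succ_iff_deriv (n := 1)).2
    ⟨fun t => (h₁ t).differentiableAt, by simp, ?_⟩
  rw [e₁, contDiff_one_iff_deriv, e₂]
  exact ⟨fun t => (h₂ t).differentiableAt, h₃⟩

lemma hasGradientAt_separable_sum (h : ∀ i t, HasDerivAt (g i) (g' i t) t)
    (u : EuclideanSpace ℝ ι) :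
    HasGradientAt (fun v : EuclideanSpace ℝ ι => ∑ i, g i (v i))
      (WithLp.toLp 2 fun i => g' i (u i)) u := by
  rw [hasGradientAt_iff_hasFDerivAt]
  have hs : HasFDerivAt (fun v : EuclideanSpace ℝ ι => ∑ i, g i (v i))
      (∑ i, g' i (u i) • (EuclideanSpace.proj i : EuclideanSpace ℝ ι →L[ℝ] ℝ)) u :=
    HasFDerivAt.fun_sum fun i _ => (h i (u i)).comp_hasFDerivAt u
      (EuclideanSpace.proj i : EuclideanSpace ℝ ι →L[ℝ] ℝ).hasFDerivAt
  refine hs.congr_fderiv ?_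
  ext v
  simp [PiLp.inner_apply, mul_comm]

lemma norm_toLp_sub_le {L : ℝ} (hL : 0 ≤ L)
    (h : ∀ i s t, |g' i s - g' i t| ≤ L * |s - t|) (u v : EuclideanSpace ℝ ι) :
    ‖(WithLp.toLp 2 fun i => g' i (u i) : EuclideanSpace ℝ ι) -
      WithLp.toLp 2 fun i => g' i (v i)‖ ≤ L * ‖u - v‖ := by
  refine le_of_sq_le_sq ?_ (by positivity)
  rw [mul_pow, EuclideanSpace.real_norm_sq_eq, EuclideanSpace.real_norm_sq_eq, Finset.mul_sum]
  refine Finset.sum_le_sum fun i _ => ?_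
  have := pow_le_pow_left₀ (abs_nonneg _) (h i (u i) (v i)) 2
  simpa [mul_pow] using this

lemma abs_sub_le_of_hasDerivAt {g g' : ℝ → ℝ} {L : ℝ} (h : ∀ t, HasDerivAt g (g' t) t)
    (hL : ∀ t, |g' t| ≤ L) (s t : ℝ) : |g s - g t| ≤ L * |s - t| :=
  Convex.norm_image_sub_le_of_norm_hasDerivWithin_le (s := Set.univ)
    (fun x _ => (h x).hasDerivWithinAt) (fun x _ => hL x) convex_univ
    (Set.mem_univ t) (Set.mem_univ s)

lemma convexOn_sub_sq_of_le_deriv2 {g g' g'' : ℝ → ℝ} {c : ℝ}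
    (h₁ : ∀ t, HasDerivAt g (g' t) t) (h₂ : ∀ t, HasDerivAt g' (g'' t) t)
    (hc : ∀ t, c ≤ g'' t) : ConvexOn ℝ Set.univ fun t => g t - 1 / 2 * (c * t ^ 2) := by
  have e₁ : ∀ t, HasDerivAt (fun t => g t - 1 / 2 * (c * t ^ 2)) (g' t - c * t) t := by
    intro t
    refine ((h₁ t).sub (((hasDerivAt_pow 2 t).const_mul c).const_mul (1 / 2))).congr_deriv ?_
    push_cast
    ring
  have e₂ : ∀ t, HasDerivAt (fun t => g' t - c * t) (g'' t - c) t := by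
    intro t
    exact ((h₂ t).sub ((hasDerivAt_id t).const_mul c)).congr_deriv (by simp)
  have e : deriv (fun t => g t - 1 / 2 * (c * t ^ 2)) = fun t => g' t - c * t :=
    funext fun t => (e₁ t).deriv
  refine Monotone.convexOn_univ_of_deriv (fun t => (e₁ t).differentiableAt) ?_
  rw [e]
  refine monotone_of_deriv_nonneg (fun t => (e₂ t).differentiableAt) fun t => ?_
  rw [(e₂ t).deriv]
  linarith [hc t]

lemma convexOn_separable_sum (h : ∀ i, ConvexOn ℝ Set.univ (g i)) :
    ConvexOn ℝ Set.univ fun v : EuclideanSpace ℝ ι => ∑ i, g i (v i) := by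
  refine ⟨convex_univ, fun x _ y _ a b ha hb hab => ?_⟩
  simp only [Finset.smul_sum, ← Finset.sum_add_distrib]
  exact Finset.sum_le_sum fun i _ => (h i).2 (Set.mem_univ (x i)) (Set.mem_univ (y i)) ha hb hab

end Separable

theorem stmt19 (m : ℕ) (hm : 0 < m)
    (Pi_ : Fin m → Set ℝ) (hPne : ∀ i, (Pi_ i).Nonempty) (hPcl : ∀ i, IsClosed (Pi_ i))
    (hPint : ∀ i, (Pi_ i).OrdConnected)
    (𝔣 : Fin m → ℝ → EReal)
    (h𝔣bot : ∀ i t, 𝔣 i t ≠ ⊥) (h𝔣prop : ∀ i, ∃ t, 𝔣 i t ≠ ⊤)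
    (h𝔣lsc : ∀ i, LowerSemicontinuous (𝔣 i)) (h𝔣conv : ∀ i, EConvex (𝔣 i))
    (F F' F'' : Fin m → ℝ → ℝ)
    (hFeq : ∀ i, ∀ t ∈ Pi_ i, 𝔣 i t = ((F i t : ℝ) : EReal))
    (hF' : ∀ i, ∀ t ∈ Pi_ i, HasDerivWithinAt (F i) (F' i t) (Pi_ i) t)
    (hF'' : ∀ i, ∀ t ∈ Pi_ i, HasDerivWithinAt (F' i) (F'' i t) (Pi_ i) t)
    (hF''cont : ∀ i, ContinuousOn (F'' i) (Pi_ i))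
    (hF''nonneg : ∀ i, ∀ t ∈ Pi_ i, 0 ≤ F'' i t)
    (hF''bdd : ∀ i, BddAbove (F'' i '' Pi_ i))
    (r : ℝ → ℝ) (hr : ContDiff ℝ 2 r)
    (hr''nonneg : ∀ t : ℝ, 0 ≤ deriv (deriv r) t)
    (hr''bdd : BddAbove (Set.range (deriv (deriv r))))
    (hr0 : r 0 = 0) (hr'0 : deriv r 0 = 0) (hr''0 : deriv (deriv r) 0 = 0) :
    (ContDiff ℝ 2 (fun u : EuclideanSpace ℝ (Fin m) =>
        ∑ i, extPiece (Pi_ i) (F i) (F' i) (F'' i) r (u i)) ∧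
      ∀ u u' : EuclideanSpace ℝ (Fin m),
        ‖gradient (fun u'' : EuclideanSpace ℝ (Fin m) =>
              ∑ i, extPiece (Pi_ i) (F i) (F' i) (F'' i) r (u'' i)) u
            - gradient (fun u'' : EuclideanSpace ℝ (Fin m) =>
              ∑ i, extPiece (Pi_ i) (F i) (F' i) (F'' i) r (u'' i)) u'‖
          ≤ ((⨆ i, sSup (F'' i '' Pi_ i)) + sSup (Set.range (deriv (deriv r)))) * ‖u - u'‖) ∧
    ((∀ i, 0 ≤ sInf (F'' i '' Pi_ i)) ∧
      ConvexOn ℝ Set.univ (fun u : EuclideanSpace ℝ (Fin m) =>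
        (∑ i, extPiece (Pi_ i) (F i) (F' i) (F'' i) r (u i))
          - (1 / 2) * ∑ i, sInf (F'' i '' Pi_ i) * (u i) ^ 2)) := by
  have hbelow : ∀ i, BddBelow (F'' i '' Pi_ i) := fun i =>
    ⟨0, by rintro _ ⟨t, ht, rfl⟩; exact hF''nonneg i t ht⟩
  have hinf : ∀ i, 0 ≤ sInf (F'' i '' Pi_ i) := fun i =>
    le_csInf ((hPne i).image _) (by rintro _ ⟨t, ht, rfl⟩; exact hF''nonneg i t ht)
  choose g' g'' hg' hg'' hg''c hg''le using fun i =>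
    exists_deriv_extPiece (hPne i) (hPcl i) (hPint i) (hF' i) (hF'' i) (hF''cont i) (hbelow i)
      (hF''bdd i) hr hr''nonneg hr''bdd hr0 hr'0 hr''0
  have hsup : ∀ i, sSup (F'' i '' Pi_ i) ≤ ⨆ i, sSup (F'' i '' Pi_ i) := fun i =>
    le_ciSup (f := fun i => sSup (F'' i '' Pi_ i)) (Set.finite_range _).bddAbove i
  have habs : ∀ i t, |g'' i t| ≤
      (⨆ i, sSup (F'' i '' Pi_ i)) + sSup (Set.range (deriv (deriv r))) := fun i t => by
    rw [abs_of_nonneg ((hinf i).trans (hg''le i t).1)]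
    linarith [hsup i, (hg''le i t).2]
  refine ⟨⟨?_, fun u u' => ?_⟩, hinf, ?_⟩
  · exact ContDiff.sum fun i _ => (contDiff_two_of_hasDerivAt (hg' i) (hg'' i) (hg''c i)).comp
      (EuclideanSpace.proj i : EuclideanSpace ℝ (Fin m) →L[ℝ] ℝ).contDiff
  · rw [(hasGradientAt_separable_sum hg' u).gradient, (hasGradientAt_separable_sum hg' u').gradient]
    exact norm_toLp_sub_le ((abs_nonneg _).trans (habs ⟨0, hm⟩ 0))
      (fun i => abs_sub_le_of_hasDerivAt (hg'' i) (habs i)) u u'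
  · simp only [Finset.mul_sum, ← Finset.sum_sub_distrib]
    exact convexOn_separable_sum fun i =>
      convexOn_sub_sq_of_le_deriv2 (hg' i) (hg'' i) fun t => (hg''le i t).1
end
end
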